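/- Let T be a tree on n vertices with maximum degree at most Δ, and let L ⊆ V(T) with |L| = k be obtainable by iterative leaf removal (i.e., there is an ordering v_1, …, v_k of L such that v_i is a leaf of T − {v_{i+1}, …, v_k} for each i... equivalently T − L is a subtree and each v_i can be re-attached as a leaf in order). Suppose H is a graph containing an embedding of T − L such that at every stage of re-attaching the deleted leaves in reverse order, the relevant switching set has size greater than the number of remaining leaves to attach. Then, if for all pairs (u,v) the switching sets have size at least b and k < b, H contains an embedding of T. -/

import Mathlib

/-- One switching step: given an embedding `ψ` of `T[D]` into `H`, a vertex `a ∉ D` whose only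
neighbour in `D` is `p`, and a vertex `t ∈ D` whose image is adjacent to that of `p` and whose
role can be taken over by an unused vertex `w`, map `a` to the old image of `t` and `t` to `w`. -/
lemma SimpleGraph.exists_switch {V W : Type*} [DecidableEq V]
    (T : SimpleGraph V) (H : SimpleGraph W) {D : Set V} {ψ : V → W}
    (hinj : Set.InjOn ψ D) (hhom : ∀ x ∈ D, ∀ y ∈ D, T.Adj x y → H.Adj (ψ x) (ψ y))
    {a p t : V} {w : W} (ha : a ∉ D) (hp : ∀ u ∈ D, T.Adj a u → u = p)
    (ht : t ∈ D) (htp : t ≠ p) (hw : w ∉ ψ '' D) (hx : H.Adj (ψ t) (ψ p))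
    (hnb : ∀ s, T.Adj t s → H.Adj (ψ s) w) :
    let ψ' := Function.update (Function.update ψ t w) a (ψ t)
    Set.InjOn ψ' (insert a D) ∧
      ∀ x ∈ insert a D, ∀ y ∈ insert a D, T.Adj x y → H.Adj (ψ' x) (ψ' y) := by
  intro ψ'
  have hψ'a : ψ' a = ψ t := by simp [ψ']
  have hψ't : ψ' t = w := by
    have : t ≠ a := fun h => ha (h ▸ ht)
    simp [ψ', this]
  have hψ' : ∀ s ∈ D, s ≠ t → ψ' s = ψ s := fun s hs hst => by
    have : s ≠ a := fun h => ha (h ▸ hs)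
    simp [ψ', this, hst]
  have hwD : ∀ s ∈ D, ψ s ≠ w := fun s hs h => hw ⟨s, hs, h⟩
  have hinjD : ∀ x ∈ D, ∀ y ∈ D, ψ' x = ψ' y → x = y := by
    intro x hxD y hyD h
    by_cases hxt : x = t <;> by_cases hyt : y = t
    · rw [hxt, hyt]
    · rw [hxt, hψ't, hψ' y hyD hyt] at h
      exact absurd h.symm (hwD y hyD)
    · rw [hyt, hψ't, hψ' x hxD hxt] at h
      exact absurd h (hwD x hxD)
    · rw [hψ' x hxD hxt, hψ' y hyD hyt] at h
      exact hinj hxD hyD h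
  have hne : ∀ y ∈ D, ψ' y ≠ ψ t := by
    intro y hyD h
    by_cases hyt : y = t
    · rw [hyt, hψ't] at h
      exact hwD t ht h.symm
    · rw [hψ' y hyD hyt] at h
      exact hyt (hinj hyD ht h)
  have hadj_a : ∀ y ∈ D, T.Adj a y → H.Adj (ψ t) (ψ' y) := by
    intro y hyD h
    obtain rfl := hp y hyD h
    rwa [hψ' y hyD htp.symm]
  have hadj_t : ∀ y ∈ D, T.Adj t y → H.Adj (ψ' y) w := by
    intro y hyD h
    rw [hψ' y hyD h.ne']
    exact hnb y h
  refine ⟨?_, ?_⟩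
  · rintro x (rfl | hxD) y (rfl | hyD) h
    · rfl
    · exact absurd (h.symm.trans hψ'a) (hne y hyD)
    · exact absurd (h.trans hψ'a) (hne x hxD)
    · exact hinjD x hxD y hyD h
  · rintro x (rfl | hxD) y (rfl | hyD) h
    · exact absurd h (T.irrefl)
    · rw [hψ'a]
      exact hadj_a y hyD h
    · rw [hψ'a]
      exact (hadj_a x hxD h.symm).symm
    · by_cases hxt : x = t
      · subst hxt
        rw [hψ't]
        exact (hadj_t y hyD h).symm
      · by_cases hyt : y = t
        · subst hyt
          rw [hψ't]
          exact hadj_t x hxD h.symm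
        · rw [hψ' x hxD hxt, hψ' y hyD hyt]
          exact hhom x hxD y hyD h


/-- Correctness of the iterative leaf-absorption for trees: let `T` be a tree of maximum
degree at most `Δ`, `L` a set of `k` vertices removable by iterative leaf deletion
(witnessed by the ordering `v`), and `φ` an embedding of `T − L` into `H`. Suppose `S`
is an independent set of embedded vertices with no `T`-neighbours in `L`, and for each
pair `(u,w)` of vertices of `H` the switching set `B u w` consists of images of vertices
of `S` adjacent to `u` whose embedded `T`-neighbours' images are adjacent to `w`, with
`|B u w| ≥ b > k`. Then `H` contains an embedding of `T`. -/
theorem stmt18 {VT VH : Type} [Fintype VT] [Fintype VH] [DecidableEq VT] [DecidableEq VH]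
    (T : SimpleGraph VT) [DecidableRel T.Adj] (hT : T.IsTree)
    (Δ n k b : ℕ) (hn : Fintype.card VT = n) (hdeg : ∀ u, T.degree u ≤ Δ)
    (H : SimpleGraph VH) (hcard : Fintype.card VT ≤ Fintype.card VH)
    (L : Finset VT) (hLcard : L.card = k)
    (v : Fin k → VT) (hvinj : Function.Injective v) (hvL : ∀ i, v i ∈ L)
    (hleaf : ∀ i : Fin k,
      (Finset.univ.filter fun u =>
        T.Adj (v i) u ∧ ∀ j : Fin k, i < j → u ≠ v j).card = 1)
    (φ : VT → VH)
    (hφinj : Set.InjOn φ {t | t ∉ L})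
    (hφhom : ∀ a c : VT, a ∉ L → c ∉ L → T.Adj a c → H.Adj (φ a) (φ c))
    (S : Finset VT) (hSL : ∀ t ∈ S, t ∉ L)
    (hSind : ∀ t ∈ S, ∀ t' ∈ S, ¬ T.Adj t t')
    (hSnb : ∀ t ∈ S, ∀ s, T.Adj t s → s ∉ L)
    (B : VH → VH → Finset VH)
    (hBstruct : ∀ u w : VH, ∀ x ∈ B u w, ∃ t ∈ S, φ t = x ∧ H.Adj x u ∧
      ∀ s, T.Adj t s → H.Adj (φ s) w)
    (hBsize : ∀ u w, b ≤ (B u w).card)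
    (hkb : k < b) :
    ∃ ψ : VT → VH, Function.Injective ψ ∧
      ∀ a c : VT, T.Adj a c → H.Adj (ψ a) (ψ c) := by
  have hrange : ∀ t ∈ L, ∃ j, v j = t := by
    have himg : Finset.univ.image v = L := by
      apply Finset.eq_of_subset_of_card_le
      · intro t ht
        obtain ⟨j, -, rfl⟩ := Finset.mem_image.1 ht
        exact hvL j
      · rw [Finset.card_image_of_injective _ hvinj, hLcard, Finset.card_univ, Fintype.card_fin]
    intro t ht
    rw [← himg] at ht
    obtain ⟨j, -, hj⟩ := Finset.mem_image.1 ht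
    exact ⟨j, hj⟩
  have key : ∀ i ≤ k, ∃ ψ : VT → VH, ∃ U : Finset VT, U.card ≤ i ∧
      (∀ t ∉ L, t ∉ U → ψ t = φ t) ∧ U ⊆ S ∧
      Set.InjOn ψ {t | ∀ j : Fin k, i ≤ j → t ≠ v j} ∧
      ∀ x ∈ {t | ∀ j : Fin k, i ≤ j → t ≠ v j}, ∀ y ∈ {t | ∀ j : Fin k, i ≤ j → t ≠ v j},
        T.Adj x y → H.Adj (ψ x) (ψ y) := by
    intro i
    induction i with
    | zero =>
      intro _
      have hD : ∀ t ∈ {t | ∀ j : Fin k, 0 ≤ (j : ℕ) → t ≠ v j}, t ∉ L := by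
        intro t ht htL
        obtain ⟨j, hj⟩ := hrange t htL
        exact ht j (Nat.zero_le _) hj.symm
      exact ⟨φ, ∅, by simp, fun _ _ _ => rfl, by simp, hφinj.mono hD,
        fun x hx y hy h => hφhom x y (hD x hx) (hD y hy) h⟩
    | succ i ih =>
      intro hik
      obtain ⟨ψ, U, hUcard, hψφ, hUS, hinj, hhom⟩ := ih (by omega)
      set D : Set VT := {t | ∀ j : Fin k, i ≤ j → t ≠ v j} with hD
      let i' : Fin k := ⟨i, hik⟩
      have hDL : ∀ t ∉ L, t ∈ D := fun t ht j _ h => ht (h ▸ hvL j)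
      have hvD : v i' ∉ D := fun h => h i' le_rfl rfl
      have hDsucc : {t | ∀ j : Fin k, i + 1 ≤ j → t ≠ v j} = insert (v i') D := by
        ext t
        constructor
        · intro h
          by_cases hti : t = v i'
          · exact Or.inl hti
          · refine Or.inr fun j hj => ?_
            rcases hj.eq_or_lt with hj | hj
            · have : j = i' := Fin.ext hj.symm
              rwa [this]
            · exact h j hj
        · rintro (rfl | h) j hj
          · exact fun h => by
              have := congrArg Fin.val (hvinj h)
              simp only [i'] at this
              omega
          · exact h j (by omega)
      obtain ⟨p, hp⟩ := Finset.card_eq_one.1 (hleaf i')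
      have hpmem : p ∈ Finset.univ.filter fun u =>
          T.Adj (v i') u ∧ ∀ j : Fin k, i' < j → u ≠ v j := by
        rw [hp]; exact Finset.mem_singleton_self p
      have hpadj : T.Adj (v i') p := (Finset.mem_filter.1 hpmem).2.1
      have hpuniq : ∀ u ∈ D, T.Adj (v i') u → u = p := by
        intro u hu hadj
        have : u ∈ Finset.univ.filter fun u =>
            T.Adj (v i') u ∧ ∀ j : Fin k, i' < j → u ≠ v j :=
          Finset.mem_filter.2 ⟨Finset.mem_univ _, hadj, fun j hj => hu j (Fin.lt_def.1 hj).le⟩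
        rw [hp] at this
        exact Finset.mem_singleton.1 this
      obtain ⟨w, hw⟩ : ∃ w, w ∉ ψ '' D := by
        by_contra! hall
        have hsub : (Finset.univ : Finset VH) ⊆ (Finset.univ.erase (v i')).image ψ := by
          intro w _
          obtain ⟨t, ht, rfl⟩ := hall w
          exact Finset.mem_image_of_mem _
            (Finset.mem_erase.2 ⟨fun h => hvD (h ▸ ht), Finset.mem_univ _⟩)
        have h₁ := (Finset.card_le_card hsub).trans Finset.card_image_le
        have h₂ := Finset.card_erase_lt_of_mem (Finset.mem_univ (v i'))
        simp only [Finset.card_univ] at h₁ h₂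
        omega
      obtain ⟨x, hxB, hxU⟩ : ∃ x ∈ B (ψ p) w, x ∉ U.image φ := by
        apply Finset.exists_mem_notMem_of_card_lt_card
        have h₁ : (U.image φ).card ≤ U.card := Finset.card_image_le
        have h₂ := hBsize (ψ p) w
        omega
      obtain ⟨t, htS, rfl, hxu, hnb⟩ := hBstruct _ _ x hxB
      have htU : t ∉ U := fun h => hxU (Finset.mem_image_of_mem φ h)
      have htψ : ψ t = φ t := hψφ t (hSL t htS) htU
      have htp : t ≠ p := by
        rintro rfl
        exact hSnb t htS _ hpadj.symm (hvL i')
      have hnbψ : ∀ s, T.Adj t s → H.Adj (ψ s) w := by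
        intro s hs
        rw [hψφ s (hSnb t htS s hs) fun h => hSind t htS s (hUS h) hs]
        exact hnb s hs
      obtain ⟨h₁, h₂⟩ := T.exists_switch H hinj hhom hvD hpuniq (hDL t (hSL t htS)) htp hw
        (htψ ▸ hxu) hnbψ
      rw [hDsucc]
      refine ⟨_, insert t U, (Finset.card_insert_le _ _).trans (by omega), ?_,
        Finset.insert_subset htS hUS, h₁, h₂⟩
      intro s hsL hsU
      rw [Finset.mem_insert, not_or] at hsU
      have hsv : s ≠ v i' := fun h => hsL (h ▸ hvL i')
      rw [Function.update_of_ne hsv, Function.update_of_ne hsU.1]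
      exact hψφ s hsL hsU.2
  obtain ⟨ψ, -, -, -, -, hinj, hhom⟩ := key k le_rfl
  have hall : ∀ t, t ∈ {t | ∀ j : Fin k, k ≤ j → t ≠ v j} :=
    fun t j hj => absurd j.isLt (by omega)
  exact ⟨ψ, fun x y h => hinj (hall x) (hall y) h, fun x y h => hhom x (hall x) y (hall y) h⟩
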